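/- Let G be a connected finite simple graph of girth at least 6, with exactly two vertices x, y of type 2, and with no vertices of type k for any k ≥ 3. Then G is almost well-covered if and only if x and y are adjacent and one of the following two conditions holds: (1) G_0 has no vertices; or (2) G_0 is isomorphic to K_2, neither x nor y has a neighbor in G_0, and the two vertices of G_0 both have degree 2 in G and are contained in an induced 6-cycle of G containing x and y. -/

import Mathlib

/-- `s` is an independent set in `G`: no two vertices of `s` are adjacent. -/
def IndepSet {V : Type*} (G : SimpleGraph V) (s : Set V) : Prop :=
  ∀ ⦃a⦄, a ∈ s → ∀ ⦃b⦄, b ∈ s → ¬ G.Adj a b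

/-- `s` is a maximal independent set in `G`. -/
def MaxIndepSet {V : Type*} (G : SimpleGraph V) (s : Set V) : Prop :=
  IndepSet G s ∧ ∀ t : Set V, IndepSet G t → s ⊆ t → s = t

/-- `α(G)`: the maximum size of an independent set of `G`. -/
noncomputable def alphaNum {V : Type*} (G : SimpleGraph V) : ℕ :=
  sSup {n | ∃ s : Set V, IndepSet G s ∧ s.ncard = n}

/-- `i(G)`: the minimum size of a maximal independent set of `G`. -/
noncomputable def iNum {V : Type*} (G : SimpleGraph V) : ℕ :=
  sInf {n | ∃ s : Set V, MaxIndepSet G s ∧ s.ncard = n}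

/-- The independence gap `μ_α(G) = α(G) - i(G)`. -/
noncomputable def indepGap {V : Type*} (G : SimpleGraph V) : ℕ :=
  alphaNum G - iNum G

/-- `G` is well-covered: all maximal independent sets have the same size. -/
def WellCovered {V : Type*} (G : SimpleGraph V) : Prop :=
  alphaNum G = iNum G

/-- `G` is almost well-covered: its independence gap equals 1. -/
def AlmostWellCovered {V : Type*} (G : SimpleGraph V) : Prop :=
  indepGap G = 1

/-- The (open) neighborhood `N(I)` of a set of vertices `I`. -/
def nbhd {V : Type*} (G : SimpleGraph V) (I : Set V) : Set V :=
  {v | ∃ u ∈ I, G.Adj u v}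

/-- `U(G)`: the set of vertices whose connected component induces a complete graph. -/
def completeU {V : Type*} (G : SimpleGraph V) : Set V :=
  {u | G.IsClique (G.connectedComponentMk u).supp}

/-- A leaf: a vertex of the graph `G - U(G)` having degree 1 there. -/
def IsLeaf {V : Type*} (G : SimpleGraph V) (v : V) : Prop :=
  v ∉ completeU G ∧ {u | u ∉ completeU G ∧ G.Adj v u}.ncard = 1

/-- An internal vertex: a vertex of `G - U(G)` that is not a leaf. -/
def IsInternal {V : Type*} (G : SimpleGraph V) (v : V) : Prop :=
  v ∉ completeU G ∧ ¬ IsLeaf G v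

/-- A vertex has type `k` if it is an internal vertex adjacent to exactly `k` leaves;
in addition every vertex of `U(G)` has type `0`. -/
def HasType {V : Type*} (G : SimpleGraph V) (v : V) (k : ℕ) : Prop :=
  (IsInternal G v ∧ {u | IsLeaf G u ∧ G.Adj v u}.ncard = k) ∨ (v ∈ completeU G ∧ k = 0)

/-- The set of vertices of type `k`; `G_k` is the subgraph induced by this set. -/
def typeSet {V : Type*} (G : SimpleGraph V) (k : ℕ) : Set V :=
  {v | HasType G v k}

/-- The maximum number of vertices in a connected component of `G`. -/
noncomputable def maxCompCard {V : Type*} (G : SimpleGraph V) : ℕ :=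
  sSup {n | ∃ c : G.ConnectedComponent, c.supp.ncard = n}

/-- `G` has no cycle of length `n`. -/
def NoCycleOfLength {V : Type*} (G : SimpleGraph V) (n : ℕ) : Prop :=
  ∀ (v : V) (w : G.Walk v v), w.IsCycle → w.length ≠ n

/-- `G` has girth at least 6: no cycle of length 3, 4, or 5. -/
def GirthAtLeastSix {V : Type*} (G : SimpleGraph V) : Prop :=
  NoCycleOfLength G 3 ∧ NoCycleOfLength G 4 ∧ NoCycleOfLength G 5

/-- A pendant edge: an edge incident with a vertex of degree 1. -/
def pendantEdges {V : Type*} (G : SimpleGraph V) : Set (Sym2 V) :=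
  {e | e ∈ G.edgeSet ∧ ∃ v ∈ e, (G.neighborSet v).ncard = 1}

/-- The pendant edges of `G` are pairwise disjoint and cover every vertex of `G`. -/
def PendantPerfectMatching {V : Type*} (G : SimpleGraph V) : Prop :=
  (∀ e ∈ pendantEdges G, ∀ f ∈ pendantEdges G, e ≠ f → ∀ v : V, v ∈ e → v ∉ f) ∧
  (∀ v : V, ∃ e ∈ pendantEdges G, v ∈ e)

theorem IndepSet.exists_maxIndepSet_superset {V : Type*} [Finite V] {G : SimpleGraph V}
    {s : Set V} (hs : IndepSet G s) : ∃ t, MaxIndepSet G t ∧ s ⊆ t := by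
  obtain ⟨t, hst, ht⟩ := Set.Finite.exists_le_maximal (Set.toFinite {t | IndepSet G t}) hs
  exact ⟨t, ⟨ht.prop, fun u hu htu => ht.eq_of_subset hu htu⟩, hst⟩

/-- A vertex outside a maximal independent set has a neighbor in it. -/
theorem MaxIndepSet.exists_adj {V : Type*} {G : SimpleGraph V} {s : Set V}
    (hs : MaxIndepSet G s) {v : V} (hv : v ∉ s) : ∃ u ∈ s, G.Adj v u := by
  by_contra! h
  have hins : IndepSet G (insert v s) := by
    rintro a (rfl | ha) b (rfl | hb)
    · exact G.irrefl
    · exact h b hb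
    · exact fun hab => h a ha hab.symm
    · exact hs.1 ha hb
  exact hv (hs.2 _ hins (Set.subset_insert v s) ▸ Set.mem_insert v s)

theorem IndepSet.ncard_le_alphaNum {V : Type*} [Finite V] {G : SimpleGraph V} {s : Set V}
    (hs : IndepSet G s) : s.ncard ≤ alphaNum G :=
  le_csSup ⟨Nat.card V, by rintro n ⟨t, -, rfl⟩; exact Set.ncard_le_card t⟩ ⟨s, hs, rfl⟩

theorem MaxIndepSet.iNum_le_ncard {V : Type*} {G : SimpleGraph V} {s : Set V}
    (hs : MaxIndepSet G s) : iNum G ≤ s.ncard :=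
  Nat.sInf_le ⟨s, hs, rfl⟩

theorem indepSet_empty {V : Type*} (G : SimpleGraph V) : IndepSet G ∅ :=
  fun _ ha => ha.elim

theorem exists_maxIndepSet_ncard_eq_iNum {V : Type*} [Finite V] (G : SimpleGraph V) :
    ∃ s, MaxIndepSet G s ∧ s.ncard = iNum G := by
  obtain ⟨t, ht, -⟩ := (indepSet_empty G).exists_maxIndepSet_superset
  exact Nat.sInf_mem (s := {n | ∃ s : Set V, MaxIndepSet G s ∧ s.ncard = n}) ⟨_, t, ht, rfl⟩

theorem exists_maxIndepSet_ncard_eq_alphaNum {V : Type*} [Finite V] (G : SimpleGraph V) :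
    ∃ s, MaxIndepSet G s ∧ s.ncard = alphaNum G := by
  obtain ⟨s, hs, hcard⟩ := Nat.sSup_mem (s := {n | ∃ s : Set V, IndepSet G s ∧ s.ncard = n})
    ⟨_, ∅, indepSet_empty G, rfl⟩
    ⟨Nat.card V, by rintro n ⟨t, -, rfl⟩; exact Set.ncard_le_card t⟩
  obtain ⟨t, ht, hst⟩ := hs.exists_maxIndepSet_superset
  exact ⟨t, ht, le_antisymm ht.1.ncard_le_alphaNum
    (hcard.symm.trans_le (Set.ncard_le_ncard hst (Set.toFinite t)))⟩

theorem NoCycleOfLength.not_adj_of_path {V : Type*} {G : SimpleGraph V} (h : NoCycleOfLength G 3)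
    {a b c : V} (hab : G.Adj a b) (hbc : G.Adj b c) : ¬ G.Adj c a := fun hca =>
  h a (.cons hab (.cons hbc (.cons hca .nil)))
    (by
      have := hab.ne; have := hbc.ne; have := hca.ne
      simp [SimpleGraph.Walk.cons_isCycle_iff, SimpleGraph.Walk.isPath_def]
      grind) rfl

theorem NoCycleOfLength.not_adj_of_path_of_four {V : Type*} {G : SimpleGraph V}
    (h : NoCycleOfLength G 4) {a b c d : V} (hab : G.Adj a b) (hbc : G.Adj b c)
    (hcd : G.Adj c d) (hac : a ≠ c) (hbd : b ≠ d) : ¬ G.Adj d a := fun hda =>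
  h a (.cons hab (.cons hbc (.cons hcd (.cons hda .nil))))
    (by
      have := hab.ne; have := hbc.ne; have := hcd.ne; have := hda.ne
      simp [SimpleGraph.Walk.cons_isCycle_iff, SimpleGraph.Walk.isPath_def]
      grind) rfl

theorem NoCycleOfLength.not_adj_of_path_of_five {V : Type*} {G : SimpleGraph V}
    (h : NoCycleOfLength G 5) {a b c d e : V} (hab : G.Adj a b) (hbc : G.Adj b c)
    (hcd : G.Adj c d) (hde : G.Adj d e) (hac : a ≠ c) (hbd : b ≠ d) (hce : c ≠ e)
    (hda : d ≠ a) (heb : e ≠ b) : ¬ G.Adj e a := fun hea =>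
  h a (.cons hab (.cons hbc (.cons hcd (.cons hde (.cons hea .nil)))))
    (by
      have := hab.ne; have := hbc.ne; have := hcd.ne; have := hde.ne; have := hea.ne
      simp [SimpleGraph.Walk.cons_isCycle_iff, SimpleGraph.Walk.isPath_def]
      grind) rfl

/-- In a connected graph, a proper nonempty set of vertices has an edge leaving it. -/
theorem SimpleGraph.Connected.exists_adj_boundary {V : Type*} {G : SimpleGraph V}
    (hG : G.Connected) {s : Set V} {u v : V} (hu : u ∈ s) (hv : v ∉ s) :
    ∃ a ∈ s, ∃ b ∉ s, G.Adj a b := by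
  obtain ⟨w⟩ := hG.preconnected u v
  obtain ⟨d, -, h1, h2⟩ := w.exists_boundary_dart s hu hv
  exact ⟨d.fst, h1, d.snd, h2, d.adj⟩

theorem nonempty_induce_iso {V W : Type*} {G : SimpleGraph V} {H : SimpleGraph W} (f : W → V)
    (hf : Function.Injective f) (hadj : ∀ i j, G.Adj (f i) (f j) ↔ H.Adj i j) :
    Nonempty (G.induce (Set.range f) ≃g H) :=
  ⟨RelIso.symm ⟨Equiv.ofInjective f hf, by simp [hadj]⟩⟩

/-- The hypotheses shared by the structural lemmas: `x` and `y` are adjacent, `W` avoids them,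
no vertex of `W` is a leaf, and every maximal independent set meets `W` in almost as many
vertices as possible. -/
structure NearlyExtremal {V : Type*} (G : SimpleGraph V) (W : Set V) (x y : V) : Prop where
  girth : GirthAtLeastSix G
  adj : G.Adj x y
  left_notMem : x ∉ W
  right_notMem : y ∉ W
  exists_adj_ne : ∀ q ∈ W, ∀ p, ∃ r, r ≠ p ∧ G.Adj q r
  ncard_le : ∀ I T, MaxIndepSet G I → T ⊆ W → IndepSet G T →
    T.ncard + (I ∩ {x, y}).ncard ≤ (I ∩ W).ncard + 1

namespace NearlyExtremal

variable {V : Type*} {G : SimpleGraph V} {W : Set V} {x y : V}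

protected theorem symm (h : NearlyExtremal G W x y) : NearlyExtremal G W y x :=
  ⟨h.girth, h.adj.symm, h.right_notMem, h.left_notMem, h.exists_adj_ne, by
    rw [Set.pair_comm]; exact h.ncard_le⟩

theorem exists_mem_adj [Finite V] (h : NearlyExtremal G W x y) {I : Set V}
    (hI : MaxIndepSet G I) (hx : x ∈ I) {p : V} (hp : p ∈ W) (hpI : p ∉ I) :
    ∃ q ∈ W, q ∈ I ∧ G.Adj p q := by
  by_contra! hno
  have hT : IndepSet G (insert p (I ∩ W)) := by
    rintro a (rfl | ha) b (rfl | hb)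
    · exact G.irrefl
    · exact hno b hb.2 hb.1
    · exact fun hab => hno a ha.2 ha.1 hab.symm
    · exact hI.1 ha.1 hb.1
  have hle := h.ncard_le I _ hI (Set.insert_subset hp Set.inter_subset_right) hT
  rw [Set.ncard_insert_of_notMem (fun hmem => hpI hmem.1) (Set.toFinite _)] at hle
  have hpos : 0 < (I ∩ {x, y}).ncard :=
    (Set.ncard_pos (Set.toFinite _)).2 ⟨x, hx, Or.inl rfl⟩
  omega

/-- If `p ∈ W` is dominated by a vertex outside `W` that is compatible with `x`, then some
neighbor `q ∈ W` of `p` has all its other neighbors equal or adjacent to `x`. -/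
theorem exists_mem_adj_forall [Finite V] (h : NearlyExtremal G W x y) {p c : V} (hp : p ∈ W)
    (hc : c ∉ W) (hcp : G.Adj c p) (hxc : ¬ G.Adj x c) :
    ∃ q ∈ W, G.Adj p q ∧ ∀ r, G.Adj q r → r ≠ p → r = x ∨ G.Adj r x := by
  obtain ⟨hg3, hg4, hg5⟩ := h.girth
  by_contra! hno
  choose! f hqf hfp hfx hfx' using hno
  have key : ∀ q ∈ W, G.Adj p q → ¬ G.Adj (f q) c := fun q hq hpq hadj =>
    hg4.not_adj_of_path_of_four hcp hpq (hqf q hq hpq) (by rintro rfl; exact hc hq)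
      (hfp q hq hpq).symm hadj
  have hS : IndepSet G ({x, c} ∪ f '' {q | q ∈ W ∧ G.Adj p q}) := by
    rintro a ((rfl | rfl) | ⟨q, ⟨hq, hpq⟩, rfl⟩) b ((rfl | rfl) | ⟨q', ⟨hq', hpq'⟩, rfl⟩)
    · exact G.irrefl
    · exact hxc
    · exact fun hadj => hfx' q' hq' hpq' hadj.symm
    · exact fun hadj => hxc hadj.symm
    · exact G.irrefl
    · exact fun hadj => key q' hq' hpq' hadj.symm
    · exact hfx' q hq hpq
    · exact key q hq hpq
    · rintro hadj
      have hne : q ≠ q' := by rintro rfl; exact G.irrefl hadj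
      refine hg5.not_adj_of_path_of_five hpq (hqf q hq hpq) hadj (hqf q' hq' hpq').symm
        (hfp q hq hpq).symm ?_ ?_ (hfp q' hq' hpq') hne.symm hpq'.symm
      · intro heq
        exact hg3.not_adj_of_path hpq' (heq ▸ hqf q' hq' hpq') hpq.symm
      · intro heq
        exact hg3.not_adj_of_path hpq (heq ▸ hqf q hq hpq) hpq'.symm
  obtain ⟨I, hI, hSI⟩ := hS.exists_maxIndepSet_superset
  have hxI : x ∈ I := hSI (Or.inl (Or.inl rfl))
  have hcI : c ∈ I := hSI (Or.inl (Or.inr rfl))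
  obtain ⟨q, hq, hqI, hpq⟩ := h.exists_mem_adj hI hxI hp (fun hpI => hI.1 hcI hpI hcp)
  exact hI.1 hqI (hSI (Or.inr ⟨q, ⟨hq, hpq⟩, rfl⟩)) (hqf q hq hpq)

theorem not_adj [Finite V] (h : NearlyExtremal G W x y) {p : V} (hp : p ∈ W) :
    ¬ G.Adj x p := by
  obtain ⟨hg3, hg4, -⟩ := h.girth
  intro hxp
  obtain ⟨q, hq, hpq, hall⟩ := h.exists_mem_adj_forall hp h.left_notMem hxp G.irrefl
  obtain ⟨r, hrp, hqr⟩ := h.exists_adj_ne q hq p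
  rcases hall r hqr hrp with rfl | hrx
  · exact hg3.not_adj_of_path hxp hpq hqr
  · exact hg4.not_adj_of_path_of_four hxp hpq hqr (by rintro rfl; exact h.left_notMem hq)
      hrp.symm hrx

theorem exists_mem_adj_iff [Finite V] (h : NearlyExtremal G W x y) {p c : V} (hp : p ∈ W)
    (hc : c ∉ W) (hcp : G.Adj c p) (hxc : ¬ G.Adj x c) :
    ∃ q ∈ W, ∃ b ∉ W, (∀ r, G.Adj q r ↔ r = p ∨ r = b) ∧ G.Adj b x := by
  obtain ⟨-, hg4, -⟩ := h.girth
  obtain ⟨q, hq, hpq, hall⟩ := h.exists_mem_adj_forall hp hc hcp hxc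
  replace hall : ∀ r, G.Adj q r → r ≠ p → G.Adj r x := fun r hqr hrp =>
    (hall r hqr hrp).resolve_left (by rintro rfl; exact h.not_adj hq hqr.symm)
  obtain ⟨b, hbp, hqb⟩ := h.exists_adj_ne q hq p
  have hbx := hall b hqb hbp
  refine ⟨q, hq, b, fun hb => h.not_adj hb hbx.symm, fun r => ⟨fun hqr => ?_, ?_⟩, hbx⟩
  · by_contra! hr
    exact hg4.not_adj_of_path_of_four hqr (hall r hqr hr.1) hbx.symm
      (by rintro rfl; exact h.left_notMem hq) hr.2 hqb.symm
  · rintro (rfl | rfl)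
    · exact hpq.symm
    · exact hqb

/-- `p` and `q` are the two middle vertices of a path `a p q b`, have no further neighbors,
and the ends `a`, `b` of the path are adjacent to `x`, `y` respectively. -/
structure IsBridge (G : SimpleGraph V) (W : Set V) (x y p q a b : V) : Prop where
  left_mem : p ∈ W
  right_mem : q ∈ W
  left_notMem : a ∉ W
  right_notMem : b ∉ W
  adj_left_iff : ∀ r, G.Adj p r ↔ r = q ∨ r = a
  adj_right_iff : ∀ r, G.Adj q r ↔ r = p ∨ r = b
  adj_left : G.Adj a x
  adj_right : G.Adj b y

theorem IsBridge.symm {p q a b : V} (h : IsBridge G W x y p q a b) :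
    IsBridge G W y x q p b a :=
  ⟨h.2, h.1, h.4, h.3, h.6, h.5, h.8, h.7⟩

theorem exists_isBridge_of_not_adj [Finite V] (h : NearlyExtremal G W x y) {p c : V}
    (hp : p ∈ W) (hc : c ∉ W) (hcp : G.Adj c p) (hxc : ¬ G.Adj x c) :
    ∃ q a b, IsBridge G W x y q p a b := by
  obtain ⟨q, hq, b, hb, hqr, hbx⟩ := h.exists_mem_adj_iff hp hc hcp hxc
  have hyb : ¬ G.Adj y b := h.girth.1.not_adj_of_path hbx h.adj
  obtain ⟨p', hp', a, ha, hpr, hay⟩ :=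
    h.symm.exists_mem_adj_iff hq hb ((hqr b).2 (Or.inr rfl)).symm hyb
  have hpp : p' = p :=
    ((hqr p').1 ((hpr q).2 (Or.inl rfl)).symm).resolve_right (by rintro rfl; exact hb hp')
  subst hpp
  exact ⟨q, b, a, hq, hp', hb, ha, hqr, hpr, hbx, hay⟩

theorem exists_isBridge [Finite V] (h : NearlyExtremal G W x y) {w c : V}
    (hw : w ∈ W) (hc : c ∉ W) (hcw : G.Adj c w) :
    ∃ p q a b, IsBridge G W x y p q a b ∧ (w = p ∨ w = q) := by
  by_cases hxc : G.Adj x c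
  · have hyc : ¬ G.Adj y c := h.girth.1.not_adj_of_path hxc.symm h.adj
    obtain ⟨q, a, b, hb⟩ := h.symm.exists_isBridge_of_not_adj hw hc hcw hyc
    exact ⟨w, q, b, a, hb.symm, Or.inl rfl⟩
  · obtain ⟨q, a, b, hb⟩ := h.exists_isBridge_of_not_adj hw hc hcw hxc
    exact ⟨q, w, a, b, hb, Or.inr rfl⟩

theorem IsBridge.not_adj_ends [Finite V] (h : NearlyExtremal G W x y) {p q a b p' q' a' b' : V}
    (hb : IsBridge G W x y p q a b) (hb' : IsBridge G W x y p' q' a' b') : ¬ G.Adj a b' := by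
  intro hadj
  refine h.girth.2.1.not_adj_of_path_of_four hb.adj_left h.adj hb'.adj_right.symm ?_ ?_ hadj.symm
  · rintro rfl
    exact h.symm.not_adj hb.left_mem ((hb.adj_left_iff _).2 (Or.inr rfl)).symm
  · rintro rfl
    exact h.not_adj hb'.right_mem ((hb'.adj_right_iff _).2 (Or.inr rfl)).symm

theorem eq_pair_of_isBridge [Finite V] (h : NearlyExtremal G W x y) (hconn : G.Connected)
    {p q a b : V} (hb : IsBridge G W x y p q a b) : W = {p, q} := by
  refine Set.Subset.antisymm (fun r hr => ?_)
    (Set.insert_subset hb.left_mem (Set.singleton_subset_iff.2 hb.right_mem))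
  by_contra hrpq
  obtain ⟨w, ⟨hw, hwpq⟩, c, hc, hwc⟩ := hconn.exists_adj_boundary (s := W \ {p, q})
    (u := r) (v := x) ⟨hr, hrpq⟩ (fun hx => h.left_notMem hx.1)
  have hcW : c ∉ W := by
    intro hcW
    have hcpq : c = p ∨ c = q := by
      by_contra! hne
      exact hc ⟨hcW, by simp [hne]⟩
    rcases hcpq with rfl | rfl
    · rcases (hb.adj_left_iff w).1 hwc.symm with rfl | rfl
      · simp at hwpq
      · exact hb.left_notMem hw
    · rcases (hb.adj_right_iff w).1 hwc.symm with rfl | rfl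
      · simp at hwpq
      · exact hb.right_notMem hw
  obtain ⟨p', q', a', b', hb', hwpq'⟩ := h.exists_isBridge hw hcW hwc.symm
  have hp'q' := (hb'.adj_left_iff q').2 (Or.inl rfl)
  have hp' : p' ≠ p ∧ p' ≠ q := by
    rcases hwpq' with rfl | rfl
    · simpa using hwpq
    · constructor
      · rintro rfl
        rcases (hb.adj_left_iff w).1 hp'q' with rfl | rfl
        · simp at hwpq
        · exact hb.left_notMem hw
      · rintro rfl
        rcases (hb.adj_right_iff w).1 hp'q' with rfl | rfl
        · simp at hwpq
        · exact hb.right_notMem hw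
  have hg3 := h.girth.1
  have hS : IndepSet G {a, b, a', b'} := by
    have hab := hb.not_adj_ends h hb
    have hab' := hb.not_adj_ends h hb'
    have ha'b := hb'.not_adj_ends h hb
    have ha'b' := hb'.not_adj_ends h hb'
    have haa' : ¬ G.Adj a a' := hg3.not_adj_of_path hb'.adj_left hb.adj_left.symm
    have hbb' : ¬ G.Adj b b' := hg3.not_adj_of_path hb'.adj_right hb.adj_right.symm
    rintro u (rfl | rfl | rfl | rfl) v (rfl | rfl | rfl | rfl) <;>
      first
      | exact G.irrefl
      | assumption
      | (rw [G.adj_comm]; assumption)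
  obtain ⟨I, hI, hSI⟩ := hS.exists_maxIndepSet_superset
  have haI : a ∈ I := hSI (by simp)
  have ha'I : a' ∈ I := hSI (by simp)
  have hbI : b ∈ I := hSI (by simp)
  have hb'I : b' ∈ I := hSI (by simp)
  have hpI : p ∉ I := fun hm => hI.1 hm haI ((hb.adj_left_iff a).2 (Or.inr rfl))
  have hqI : q ∉ I := fun hm => hI.1 hm hbI ((hb.adj_right_iff b).2 (Or.inr rfl))
  have hp'I : p' ∉ I := fun hm => hI.1 hm ha'I ((hb'.adj_left_iff a').2 (Or.inr rfl))
  have hq'I : q' ∉ I := fun hm => hI.1 hm hb'I ((hb'.adj_right_iff b').2 (Or.inr rfl))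
  have hpnot : ∀ r ∈ I ∩ W, ¬ G.Adj p r := fun r hrm hadj => by
    rcases (hb.adj_left_iff r).1 hadj with rfl | rfl
    exacts [hqI hrm.1, hb.left_notMem hrm.2]
  have hp'not : ∀ r ∈ I ∩ W, ¬ G.Adj p' r := fun r hrm hadj => by
    rcases (hb'.adj_left_iff r).1 hadj with rfl | rfl
    exacts [hq'I hrm.1, hb'.left_notMem hrm.2]
  have hpp' : ¬ G.Adj p p' := fun hadj => by
    rcases (hb.adj_left_iff p').1 hadj with rfl | rfl
    exacts [hp'.2 rfl, hb.left_notMem hb'.left_mem]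
  have hT : IndepSet G (insert p (insert p' (I ∩ W))) := by
    rintro u (rfl | rfl | hu) v (rfl | rfl | hv)
    · exact G.irrefl
    · exact hpp'
    · exact hpnot v hv
    · exact fun hadj => hpp' hadj.symm
    · exact G.irrefl
    · exact hp'not v hv
    · exact fun hadj => hpnot u hu hadj.symm
    · exact fun hadj => hp'not u hu hadj.symm
    · exact hI.1 hu.1 hv.1
  have hle := h.ncard_le I _ hI (Set.insert_subset hb.left_mem
    (Set.insert_subset hb'.left_mem Set.inter_subset_right)) hT
  rw [Set.ncard_insert_of_notMem (by simp [hp'.1.symm, hpI]) (Set.toFinite _),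
    Set.ncard_insert_of_notMem (fun hm => hp'I hm.1) (Set.toFinite _)] at hle
  omega

theorem IsBridge.exists_induce_iso_cycleGraph [Finite V] (h : NearlyExtremal G W x y)
    {p q a b : V} (hb : IsBridge G W x y p q a b) :
    ∃ s : Set V, {p, q} ⊆ s ∧ x ∈ s ∧ y ∈ s ∧
      Nonempty (G.induce s ≃g SimpleGraph.cycleGraph 6) := by
  have hxp := h.not_adj hb.left_mem
  have hxq := h.not_adj hb.right_mem
  have hyp := h.symm.not_adj hb.left_mem
  have hyq := h.symm.not_adj hb.right_mem
  have hpq := (hb.adj_left_iff q).2 (Or.inl rfl)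
  have hpa := (hb.adj_left_iff a).2 (Or.inr rfl)
  have hqb := (hb.adj_right_iff b).2 (Or.inr rfl)
  have hax := hb.adj_left
  have hby := hb.adj_right
  have hxy := h.adj
  have hab := hb.not_adj_ends h hb
  have hay : ¬ G.Adj y a := h.girth.1.not_adj_of_path hax hxy
  have hbx : ¬ G.Adj x b := h.girth.1.not_adj_of_path hby hxy.symm
  have haq : ¬ G.Adj q a := fun hadj => h.girth.1.not_adj_of_path hpq hadj hpa.symm
  have hbp : ¬ G.Adj b p := h.girth.1.not_adj_of_path hpq hqb
  refine ⟨Set.range ![x, a, p, q, b, y], ?_, ⟨0, rfl⟩, ⟨5, rfl⟩,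
    nonempty_induce_iso _ ?_ fun i j => ?_⟩
  · rintro r (rfl | rfl)
    exacts [⟨2, rfl⟩, ⟨3, rfl⟩]
  · have := hb.left_mem; have := hb.right_mem; have := hb.left_notMem; have := hb.right_notMem
    have := h.left_notMem; have := h.right_notMem
    intro i j hij
    fin_cases i <;> fin_cases j <;> simp at hij ⊢ <;>
      grind [SimpleGraph.Adj.symm, SimpleGraph.irrefl]
  · fin_cases i <;> fin_cases j <;> simp [SimpleGraph.cycleGraph_adj, *] <;>
      grind [SimpleGraph.Adj.symm, SimpleGraph.irrefl]

end NearlyExtremal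

/-- `L` is an independent set of leaves, and every vertex outside `L` has exactly
0, 1 or 2 neighbors in `L` according to whether it lies in `W`, in neither `W` nor `D`, or in `D`. -/
structure LeafPartition {V : Type*} (G : SimpleGraph V) (L W D : Set V) : Prop where
  indepSet : IndepSet G L
  exists_adj_iff : ∀ l ∈ L, ∃ v, ∀ u, G.Adj l u ↔ u = v
  disjoint_left : Disjoint W L
  disjoint_right : Disjoint D L
  cases : ∀ v ∉ L, (v ∈ W ∧ v ∉ D ∧ {u | u ∈ L ∧ G.Adj v u}.ncard = 0) ∨
    (v ∉ W ∧ v ∉ D ∧ {u | u ∈ L ∧ G.Adj v u}.ncard = 1) ∨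
    (v ∉ W ∧ v ∈ D ∧ {u | u ∈ L ∧ G.Adj v u}.ncard = 2)

namespace LeafPartition

variable {V : Type*} {G : SimpleGraph V} {L W D : Set V}

theorem ncard_add_ncard_inter [Finite V] (h : LeafPartition G L W D) {I : Set V}
    (hI : MaxIndepSet G I) : I.ncard + (I ∩ D).ncard = L.ncard + (I ∩ W).ncard := by
  classical
  have := Fintype.ofFinite V
  choose! σ hσ using h.exists_adj_iff
  have hfib : (L \ I).ncard = ∑ v ∈ (I \ L).toFinset, {u | u ∈ L ∧ G.Adj v u}.ncard := by
    rw [Set.ncard_eq_toFinset_card', Finset.card_eq_sum_card_fiberwise (f := σ)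
      (t := (I \ L).toFinset)]
    · refine Finset.sum_congr rfl fun v hv => ?_
      rw [Set.ncard_eq_toFinset_card']
      congr 1
      ext u
      simp only [Set.mem_toFinset, Set.mem_sdiff] at hv
      simp only [Finset.mem_filter, Set.mem_toFinset, Set.mem_sdiff, Set.mem_ofPred_eq]
      constructor
      · rintro ⟨⟨hu, -⟩, rfl⟩
        exact ⟨hu, ((hσ u hu _).2 rfl).symm⟩
      · rintro ⟨hu, hadj⟩
        exact ⟨⟨hu, fun huI => hI.1 hv.1 huI hadj⟩, ((hσ u hu v).1 hadj.symm).symm⟩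
    · intro l hl
      simp only [Set.coe_toFinset, Set.mem_sdiff] at hl ⊢
      obtain ⟨u, hu, hadj⟩ := hI.exists_adj hl.2
      obtain rfl := (hσ l hl.1 u).1 hadj
      exact ⟨hu, fun hul => h.indepSet hl.1 hul hadj⟩
  have hind : ∀ X : Set V, Disjoint X L →
      (I ∩ X).ncard = ∑ v ∈ (I \ L).toFinset, if v ∈ X then 1 else 0 := by
    intro X hX
    rw [← Finset.card_filter, Set.ncard_eq_toFinset_card']
    congr 1
    ext v
    have hvX : v ∈ X → v ∉ L := fun hv => Set.disjoint_left.1 hX hv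
    simp only [Set.mem_toFinset, Set.mem_inter_iff, Finset.mem_filter, Set.mem_sdiff]
    tauto
  have hsum : (I \ L).ncard + (I ∩ D).ncard = (L \ I).ncard + (I ∩ W).ncard := by
    rw [hfib, hind D h.disjoint_right, hind W h.disjoint_left, Set.ncard_eq_toFinset_card',
      Finset.card_eq_sum_ones, ← Finset.sum_add_distrib, ← Finset.sum_add_distrib]
    refine Finset.sum_congr rfl fun v hv => ?_
    rcases h.cases v (Set.mem_toFinset.1 hv).2 with ⟨h1, h2, h3⟩ | ⟨h1, h2, h3⟩ | ⟨h1, h2, h3⟩ <;>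
      simp [h1, h2, h3]
  have h1 := Set.ncard_inter_add_ncard_sdiff_eq_ncard I L (Set.toFinite I)
  have h2 := Set.ncard_inter_add_ncard_sdiff_eq_ncard L I (Set.toFinite L)
  rw [Set.inter_comm] at h2
  omega

theorem ncard_add_le_alphaNum [Finite V] (h : LeafPartition G L W D) {T : Set V} (hTW : T ⊆ W)
    (hT : IndepSet G T) : L.ncard + T.ncard ≤ alphaNum G := by
  have hLT : ∀ l ∈ L, ∀ t ∈ T, ¬ G.Adj t l := by
    intro l hl t ht hadj
    have htW := hTW ht
    have h0 : {u | u ∈ L ∧ G.Adj t u}.ncard = 0 := by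
      rcases h.cases t (Set.disjoint_left.1 h.disjoint_left htW) with h' | h' | h'
      exacts [h'.2.2, (h'.1 htW).elim, (h'.1 htW).elim]
    rw [Set.ncard_eq_zero (Set.toFinite _)] at h0
    exact (h0 ▸ (⟨hl, hadj⟩ : l ∈ {u | u ∈ L ∧ G.Adj t u}) : l ∈ (∅ : Set V))
  have hind : IndepSet G (L ∪ T) := by
    rintro a (ha | ha) b (hb | hb)
    · exact h.indepSet ha hb
    · exact fun hadj => hLT a ha b hb hadj.symm
    · exact hLT b hb a ha
    · exact hT ha hb
  rw [← Set.ncard_union_eq (h.disjoint_left.mono_left hTW).symm (Set.toFinite _) (Set.toFinite _)]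
  exact hind.ncard_le_alphaNum

theorem ncard_le_of_almostWellCovered [Finite V] (h : LeafPartition G L W D)
    (hG : AlmostWellCovered G) {I T : Set V} (hI : MaxIndepSet G I) (hTW : T ⊆ W)
    (hT : IndepSet G T) : T.ncard + (I ∩ D).ncard ≤ (I ∩ W).ncard + 1 := by
  have h1 := h.ncard_add_ncard_inter hI
  have h2 := h.ncard_add_le_alphaNum hTW hT
  have h3 := hI.iNum_le_ncard
  unfold AlmostWellCovered indepGap at hG
  omega

theorem almostWellCovered [Finite V] (h : LeafPartition G L W D) {x : V} (hx : x ∈ D) {T : Set V}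
    (hTW : T ⊆ W) (hT : IndepSet G T)
    (hle : ∀ I, MaxIndepSet G I → (I ∩ W).ncard ≤ T.ncard)
    (hge : ∀ I, MaxIndepSet G I → T.ncard + (I ∩ D).ncard ≤ (I ∩ W).ncard + 1) :
    AlmostWellCovered G := by
  have hα := h.ncard_add_le_alphaNum hTW hT
  obtain ⟨A, hA, hAcard⟩ := exists_maxIndepSet_ncard_eq_alphaNum G
  obtain ⟨B, hB, hBcard⟩ := exists_maxIndepSet_ncard_eq_iNum G
  have hx1 : IndepSet G {x} := by
    rintro a rfl b rfl
    exact G.irrefl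
  obtain ⟨X, hX, hxX⟩ := hx1.exists_maxIndepSet_superset
  have hXD : 0 < (X ∩ D).ncard :=
    (Set.ncard_pos (Set.toFinite _)).2 ⟨x, hxX rfl, hx⟩
  have hA' := h.ncard_add_ncard_inter hA
  have hB' := h.ncard_add_ncard_inter hB
  have hX' := h.ncard_add_ncard_inter hX
  have := hle A hA
  have := hge B hB
  have := hle X hX
  have := hX.iNum_le_ncard
  unfold AlmostWellCovered indepGap
  omega

end LeafPartition

theorem isLeaf_iff_of_completeU_eq_empty {V : Type*} {G : SimpleGraph V}
    (hU : completeU G = ∅) {v : V} : IsLeaf G v ↔ (G.neighborSet v).ncard = 1 := by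
  simp [IsLeaf, hU, SimpleGraph.neighborSet]

theorem SimpleGraph.Connected.completeU_eq_empty {V : Type*} {G : SimpleGraph V}
    (hG : G.Connected) {x : V} (hx : x ∉ completeU G) : completeU G = ∅ := by
  refine Set.eq_empty_of_forall_notMem fun u hu => hx ?_
  have : G.connectedComponentMk x = G.connectedComponentMk u :=
    SimpleGraph.ConnectedComponent.sound (hG.preconnected x u)
  simpa [completeU, this] using hu

theorem SimpleGraph.Connected.exists_adj_ne_of_ncard_ne_one {V : Type*} [Nontrivial V]
    {G : SimpleGraph V} (hG : G.Connected) {q : V} (hq : (G.neighborSet q).ncard ≠ 1) (p : V) :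
    ∃ r, r ≠ p ∧ G.Adj q r := by
  by_contra! h
  obtain ⟨r, hr⟩ := hG.preconnected.exists_adj_of_nontrivial q
  refine hq (Set.ncard_eq_one.2 ⟨r, ?_⟩)
  ext u
  refine ⟨fun hu => ?_, ?_⟩
  · have h1 : u = p := by_contra fun hne => h u hne hu
    have h2 : r = p := by_contra fun hne => h r hne hr
    exact h1.trans h2.symm
  · rintro rfl
    exact hr

theorem leafPartition_of_hasType {V : Type*} {G : SimpleGraph V}
    (hconn : G.Connected) {x y : V} (hx : HasType G x 2) (hy : HasType G y 2)
    (honly : ∀ v : V, HasType G v 2 → v = x ∨ v = y)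
    (hno3 : ∀ (v : V) (k : ℕ), 3 ≤ k → ¬ HasType G v k) (hU : completeU G = ∅) :
    LeafPartition G {v | IsLeaf G v} (typeSet G 0) {x, y} := by
  have htype : ∀ v k, HasType G v k ↔ ¬ IsLeaf G v ∧ {u | IsLeaf G u ∧ G.Adj v u}.ncard = k := by
    simp [HasType, IsInternal, hU]
  have hleaf : ∀ l, IsLeaf G l → ∃ v, ∀ u, G.Adj l u ↔ u = v := by
    intro l hl
    obtain ⟨v, hv⟩ := Set.ncard_eq_one.1 ((isLeaf_iff_of_completeU_eq_empty hU).1 hl)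
    exact ⟨v, fun u => Set.ext_iff.1 hv u⟩
  refine ⟨?_, hleaf, ?_, ?_, ?_⟩
  · intro a ha b hb hab
    have hxa : x ∉ ({a, b} : Set V) := by
      rintro (rfl | rfl)
      exacts [((htype _ _).1 hx).1 ha, ((htype _ _).1 hx).1 hb]
    obtain ⟨u, hu, v, hv, huv⟩ := hconn.exists_adj_boundary (Set.mem_insert a {b}) hxa
    obtain ⟨a', ha'⟩ := hleaf a ha
    obtain ⟨b', hb'⟩ := hleaf b hb
    obtain rfl := (ha' b).1 hab
    obtain rfl := (hb' a).1 hab.symm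
    rcases hu with rfl | rfl
    · exact hv (Or.inr ((ha' v).1 huv))
    · exact hv (Or.inl ((hb' v).1 huv))
  · exact Set.disjoint_left.2 fun v hv => ((htype v 0).1 hv).1
  · refine Set.disjoint_left.2 ?_
    rintro v (rfl | rfl)
    exacts [((htype _ _).1 hx).1, ((htype _ _).1 hy).1]
  · intro v hv
    have hv' : HasType G v {u | IsLeaf G u ∧ G.Adj v u}.ncard := (htype v _).2 ⟨hv, rfl⟩
    have hlt : {u | IsLeaf G u ∧ G.Adj v u}.ncard < 3 := by
      by_contra! hge
      exact hno3 v _ hge hv'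
    have hW : v ∈ typeSet G 0 ↔ {u | IsLeaf G u ∧ G.Adj v u}.ncard = 0 :=
      (htype v 0).trans (and_iff_right hv)
    have hD : v ∈ ({x, y} : Set V) ↔ {u | IsLeaf G u ∧ G.Adj v u}.ncard = 2 := by
      refine Iff.trans ⟨?_, honly v⟩ ((htype v 2).trans (and_iff_right hv))
      rintro (rfl | rfl) <;> assumption
    rw [hW, hD]
    simp only [Set.mem_ofPred_eq]
    omega

theorem cycleGraph_six_exists_adj : ∀ u v x y : Fin 6, (SimpleGraph.cycleGraph 6).Adj u v →
    (SimpleGraph.cycleGraph 6).Adj x y → ¬ (SimpleGraph.cycleGraph 6).Adj x u →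
    ¬ (SimpleGraph.cycleGraph 6).Adj x v → ¬ (SimpleGraph.cycleGraph 6).Adj y u →
    ¬ (SimpleGraph.cycleGraph 6).Adj y v → ∃ a b, (SimpleGraph.cycleGraph 6).Adj u a ∧
      (SimpleGraph.cycleGraph 6).Adj v b ∧ a ≠ v ∧ b ≠ u ∧
      ((SimpleGraph.cycleGraph 6).Adj a x ∨ (SimpleGraph.cycleGraph 6).Adj b x) ∧
      ((SimpleGraph.cycleGraph 6).Adj a y ∨ (SimpleGraph.cycleGraph 6).Adj b y) := by
  simp only [SimpleGraph.cycleGraph_adj]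
  intro u v x y huv hxy hxu hxv hyu hyv
  refine ⟨u + u - v, v + v - u, ?_⟩
  revert u v x y
  decide

theorem IndepSet.ncard_inter_pair_le_one {V : Type*} {G : SimpleGraph V} {I : Set V}
    (hI : IndepSet G I) {u v : V} (huv : G.Adj u v) : (I ∩ {u, v}).ncard ≤ 1 := by
  refine (Set.ncard_le_one ((Set.toFinite {u, v}).inter_of_right I)).2 ?_
  rintro a ⟨ha, rfl | rfl⟩ b ⟨hb, rfl | rfl⟩
  · rfl
  · exact (hI ha hb huv).elim
  · exact (hI hb ha huv).elim
  · rfl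

/-- A maximal independent set missing two adjacent vertices of degree 2 on an induced 6-cycle
through the edge `xy` also misses `x` and `y`. -/
theorem MaxIndepSet.inter_pair_eq_empty {V : Type*} {G : SimpleGraph V} {I s : Set V}
    (hI : MaxIndepSet G I) {u v x y : V} (huv : G.Adj u v) (hxy : G.Adj x y)
    (hxu : ¬ G.Adj x u) (hxv : ¬ G.Adj x v) (hyu : ¬ G.Adj y u) (hyv : ¬ G.Adj y v)
    (hu2 : (G.neighborSet u).ncard = 2) (hv2 : (G.neighborSet v).ncard = 2)
    (hus : u ∈ s) (hvs : v ∈ s) (hxs : x ∈ s) (hys : y ∈ s)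
    (φ : G.induce s ≃g SimpleGraph.cycleGraph 6) (huI : u ∉ I) (hvI : v ∉ I) :
    I ∩ {x, y} = ∅ := by
  have hφ : ∀ (c d : V) (hc : c ∈ s) (hd : d ∈ s),
      (SimpleGraph.cycleGraph 6).Adj (φ ⟨c, hc⟩) (φ ⟨d, hd⟩) ↔ G.Adj c d :=
    fun c d hc hd => φ.map_adj_iff
  obtain ⟨a, b, hua, hvb, hav, hbu, hx, hy⟩ := cycleGraph_six_exists_adj
    (φ ⟨u, hus⟩) (φ ⟨v, hvs⟩) (φ ⟨x, hxs⟩) (φ ⟨y, hys⟩) ((hφ ..).2 huv) ((hφ ..).2 hxy)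
    (by rwa [hφ]) (by rwa [hφ]) (by rwa [hφ]) (by rwa [hφ])
  obtain ⟨⟨a, has⟩, rfl⟩ := φ.surjective a
  obtain ⟨⟨b, hbs⟩, rfl⟩ := φ.surjective b
  simp only [hφ, ne_eq, EmbeddingLike.apply_eq_iff_eq, Subtype.mk.injEq] at hua hvb hav hbu hx hy
  have key : ∀ p q c : V, (G.neighborSet p).ncard = 2 → G.Adj p q → G.Adj p c → c ≠ q → p ∉ I →
      q ∉ I → c ∈ I := by
    intro p q c hp2 hpq hpc hcq hpI hqI
    have hN : {c, q} = G.neighborSet p := Set.eq_of_subset_of_ncard_le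
      (Set.insert_subset hpc (Set.singleton_subset_iff.2 hpq))
      (by rw [hp2, Set.ncard_pair hcq]) (Set.finite_of_ncard_ne_zero (by omega))
    obtain ⟨d, hdI, hpd⟩ := hI.exists_adj hpI
    have hd : d ∈ ({c, q} : Set V) := hN ▸ hpd
    rcases hd with rfl | rfl
    exacts [hdI, (hqI hdI).elim]
  have haI := key u v a hu2 huv hua hav huI hvI
  have hbI := key v u b hv2 huv.symm hvb hbu hvI huI
  refine Set.eq_empty_of_forall_notMem ?_
  rintro z ⟨hz, rfl | rfl⟩
  · exact hx.elim (hI.1 haI hz) (hI.1 hbI hz)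
  · exact hy.elim (hI.1 haI hz) (hI.1 hbI hz)

theorem exists_eq_pair_of_induce_iso_top {V : Type*} {G : SimpleGraph V} {W : Set V}
    (φ : G.induce W ≃g (⊤ : SimpleGraph (Fin 2))) : ∃ u v, W = {u, v} ∧ G.Adj u v := by
  refine ⟨φ.symm 0, φ.symm 1, ?_, ?_⟩
  · ext w
    refine ⟨fun hw => ?_, ?_⟩
    · have h2 : φ ⟨w, hw⟩ = 0 ∨ φ ⟨w, hw⟩ = 1 := by omega
      rcases h2 with h2 | h2
      · left; rw [← h2]; simp
      · right; rw [← h2]; simp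
    · rintro (rfl | rfl) <;> exact Subtype.property _
  · exact φ.symm.map_adj_iff.2 (by simp)

theorem induce_pair_iso_top {V : Type*} {G : SimpleGraph V} {u v : V} (huv : G.Adj u v) :
    Nonempty (G.induce {u, v} ≃g (⊤ : SimpleGraph (Fin 2))) := by
  have hrange : Set.range ![u, v] = {u, v} := by simp [Set.pair_comm]
  rw [← hrange]
  refine nonempty_induce_iso _ ?_ fun i j => ?_
  · have := huv.ne
    intro i j hij
    fin_cases i <;> fin_cases j <;> simp_all
  · fin_cases i <;> fin_cases j <;> simp [huv, huv.symm]

/-- Characterization of almost well-covered connected graphs of girth at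
least 6 with exactly two vertices of type 2 (and no vertices of type `k ≥ 3`). -/
theorem two_type2_characterization {V : Type*} [Fintype V] (G : SimpleGraph V)
    (hconn : G.Connected) (hg : GirthAtLeastSix G)
    (x y : V) (hxy : x ≠ y) (hx : HasType G x 2) (hy : HasType G y 2)
    (honly : ∀ v : V, HasType G v 2 → v = x ∨ v = y)
    (hno3 : ∀ (v : V) (k : ℕ), 3 ≤ k → ¬ HasType G v k) :
    AlmostWellCovered G ↔
      G.Adj x y ∧
        (typeSet G 0 = ∅ ∨
          (Nonempty (G.induce (typeSet G 0) ≃g (⊤ : SimpleGraph (Fin 2))) ∧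
            (∀ u ∈ typeSet G 0, ¬ G.Adj x u ∧ ¬ G.Adj y u) ∧
            (∀ u ∈ typeSet G 0, (G.neighborSet u).ncard = 2) ∧
            ∃ s : Set V, typeSet G 0 ⊆ s ∧ x ∈ s ∧ y ∈ s ∧
              Nonempty (G.induce s ≃g SimpleGraph.cycleGraph 6))) := by
  have : Nontrivial V := ⟨x, y, hxy⟩
  have hU : completeU G = ∅ := hconn.completeU_eq_empty (x := x) (by
    rcases hx with h | h
    exacts [h.1.1, (two_ne_zero h.2).elim])
  have hpart := leafPartition_of_hasType hconn hx hy honly hno3 hU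
  have hxD : x ∈ ({x, y} : Set V) := Or.inl rfl
  have hyD : y ∈ ({x, y} : Set V) := Or.inr rfl
  constructor
  · intro hG
    have hle := fun I T hI hTW hT =>
      hpart.ncard_le_of_almostWellCovered (I := I) (T := T) hG hI hTW hT
    have hadj : G.Adj x y := by
      by_contra hnot
      have hS : IndepSet G {x, y} := by
        rintro a (rfl | rfl) b (rfl | rfl)
        exacts [G.irrefl, hnot, fun h => hnot h.symm, G.irrefl]
      obtain ⟨I, hI, hSI⟩ := hS.exists_maxIndepSet_superset
      have := hle I (I ∩ typeSet G 0) hI Set.inter_subset_right (fun a ha b hb => hI.1 ha.1 hb.1)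
      rw [Set.inter_eq_right.2 hSI, Set.ncard_pair hxy] at this
      omega
    refine ⟨hadj, ?_⟩
    have hnotMem : ∀ v ∈ ({x, y} : Set V), v ∉ typeSet G 0 := by
      intro v hvD hvW
      rcases hpart.cases v (Set.disjoint_left.1 hpart.disjoint_right hvD) with h | h | h
      exacts [h.2.1 hvD, h.1 hvW, h.1 hvW]
    have hN : NearlyExtremal G (typeSet G 0) x y :=
      ⟨hg, hadj, hnotMem x hxD, hnotMem y hyD, fun q hq =>
        hconn.exists_adj_ne_of_ncard_ne_one fun h1 => Set.disjoint_left.1 hpart.disjoint_left hq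
          ((isLeaf_iff_of_completeU_eq_empty hU).2 h1), hle⟩
    rcases (typeSet G 0).eq_empty_or_nonempty with hW | ⟨w, hw⟩
    · exact Or.inl hW
    right
    obtain ⟨w, hw, c, hc, hwc⟩ := hconn.exists_adj_boundary hw (hnotMem x hxD)
    obtain ⟨p, q, a, b, hb, -⟩ := hN.exists_isBridge hw hc hwc.symm
    have hW := hN.eq_pair_of_isBridge hconn hb
    refine ⟨?_, fun u hu => ⟨hN.not_adj hu, hN.symm.not_adj hu⟩, ?_, ?_⟩
    · rw [hW]
      exact induce_pair_iso_top ((hb.adj_left_iff q).2 (Or.inl rfl))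
    · rw [hW]
      rintro u (rfl | rfl)
      · rw [show G.neighborSet u = {q, a} from Set.ext hb.adj_left_iff, Set.ncard_pair]
        rintro rfl
        exact hb.left_notMem hb.right_mem
      · rw [show G.neighborSet u = {p, b} from Set.ext hb.adj_right_iff, Set.ncard_pair]
        rintro rfl
        exact hb.right_notMem hb.left_mem
    · rw [hW]
      exact hb.exists_induce_iso_cycleGraph hN
  · rintro ⟨hadj, hW | ⟨⟨φ⟩, hnot, hdeg, s, hWs, hxs, hys, ⟨ψ⟩⟩⟩
    · refine hpart.almostWellCovered hxD (Set.empty_subset _) (indepSet_empty G) ?_ ?_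
      · simp [hW]
      · intro I hI
        simpa [hW] using hI.1.ncard_inter_pair_le_one hadj
    · obtain ⟨u, v, hW, huv⟩ := exists_eq_pair_of_induce_iso_top φ
      have hu : u ∈ typeSet G 0 := by simp [hW]
      have hv : v ∈ typeSet G 0 := by simp [hW]
      have hu1 : IndepSet G {u} := by
        rintro a rfl b rfl
        exact G.irrefl
      refine hpart.almostWellCovered hxD (Set.singleton_subset_iff.2 hu) hu1 ?_ ?_
      · intro I hI
        rw [Set.ncard_singleton, hW]
        exact hI.1.ncard_inter_pair_le_one huv
      · intro I hI
        rw [Set.ncard_singleton]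
        rcases (I ∩ typeSet G 0).eq_empty_or_nonempty with hempty | hne
        · rw [hI.inter_pair_eq_empty huv hadj (hnot u hu).1 (hnot v hv).1 (hnot u hu).2
            (hnot v hv).2 (hdeg u hu) (hdeg v hv) (hWs hu) (hWs hv) hxs hys ψ
            (fun h => Set.eq_empty_iff_forall_notMem.1 hempty u ⟨h, hu⟩)
            (fun h => Set.eq_empty_iff_forall_notMem.1 hempty v ⟨h, hv⟩), Set.ncard_empty]
          omega
        · have h1 := (Set.ncard_pos (Set.toFinite _)).2 hne
          have h2 := hI.1.ncard_inter_pair_le_one hadj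
          omega
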